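/- arXiv:2111.01262 — 7 statements merged into one kernel-verified Lean document; each statement's English description precedes it below -/
import Mathlib

section
/- Let g : 2^V → [0, ∞) be nonnegative, monotone, and submodular on a finite set V. Let k ≥ 1, let S ⊆ V with |S| = k, and let B ⊆ V with |B| ≤ k. Let e* ∈ S be an element maximizing g(S \ {e}) over e ∈ S, and let v* ∈ V be an element maximizing g((S \ {e*}) ∪ {v}) over v ∈ V. Then the replacement-greedy exchange inequality holds: g((S \ {e*}) ∪ {v*}) − g(S) ≥ (1/k) · ( g(B) − 2 g(S) ). -/
/-- The gain of adding `B` to `A` is at most the sum of the gains of the single elements of `B`. -/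
theorem submodular_union_sub_le_sum {V : Type*} [DecidableEq V] {g : Finset V → ℝ}
    (hsub : ∀ S T : Finset V, g (S ∩ T) + g (S ∪ T) ≤ g S + g T)
    (hmono : ∀ S T : Finset V, S ⊆ T → g S ≤ g T) (A B : Finset V) :
    g (A ∪ B) - g A ≤ ∑ b ∈ B, (g (A ∪ {b}) - g A) := by
  induction B using Finset.induction_on with
  | empty => simp
  | insert b B hb ih =>
    rw [Finset.sum_insert hb]
    have h := hsub (A ∪ B) (A ∪ {b})
    have hle := hmono A ((A ∪ B) ∩ (A ∪ {b}))
      (Finset.subset_inter Finset.subset_union_left Finset.subset_union_left)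
    have hunion : (A ∪ B) ∪ (A ∪ {b}) = A ∪ insert b B := by grind
    rw [hunion] at h
    linarith

/-- The losses from erasing single elements of `T` from `S` sum to at most the loss from removing
all of `T`. -/
theorem submodular_sum_sub_erase_le {V : Type*} [DecidableEq V] {g : Finset V → ℝ}
    (hsub : ∀ S T : Finset V, g (S ∩ T) + g (S ∪ T) ≤ g S + g T) (S T : Finset V) :
    ∑ e ∈ T, (g S - g (S.erase e)) ≤ g S - g (S \ T) := by
  induction T using Finset.induction_on with
  | empty => simp
  | insert e T he ih =>
    rw [Finset.sum_insert he]
    have h := hsub (S \ T) (S.erase e)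
    have hinter : (S \ T) ∩ S.erase e = S \ insert e T := by grind
    have hunion : (S \ T) ∪ S.erase e = S := by grind
    rw [hinter, hunion] at h
    linarith

/-- (Replacement-greedy exchange inequality.) Let `g` be a
nonnegative, monotone, submodular set function on a finite set `V`, `k ≥ 1`,
`S ⊆ V` with `|S| = k`, and `B ⊆ V` with `|B| ≤ k`. If `e* ∈ S` maximizes
`g(S \ {e})` over `e ∈ S` and `v* ∈ V` maximizes `g((S \ {e*}) ∪ {v})` over
`v ∈ V`, then `g((S \ {e*}) ∪ {v*}) − g(S) ≥ (1/k)·(g(B) − 2·g(S))`. -/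
theorem replacement_greedy_exchange_inequality
    (V : Type) [Fintype V] [DecidableEq V]
    (g : Finset V → ℝ)
    (hnn : ∀ S : Finset V, 0 ≤ g S)
    (hsub : ∀ S T : Finset V, g (S ∩ T) + g (S ∪ T) ≤ g S + g T)
    (hmono : ∀ S T : Finset V, S ⊆ T → g S ≤ g T)
    (k : ℕ) (hk : 1 ≤ k)
    (S : Finset V) (hS : S.card = k)
    (B : Finset V) (hB : B.card ≤ k)
    (estar : V) (hestar_mem : estar ∈ S)
    (hestar_max : ∀ e ∈ S, g (S.erase e) ≤ g (S.erase estar))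
    (vstar : V)
    (hvstar_max : ∀ v : V, g ((S.erase estar) ∪ {v}) ≤ g ((S.erase estar) ∪ {vstar})) :
    (1 / (k : ℝ)) * (g B - 2 * g S) ≤ g ((S.erase estar) ∪ {vstar}) - g S := by
  set A := S.erase estar
  set M := g (A ∪ {vstar})
  have hk' : (0 : ℝ) < k := by exact_mod_cast hk
  have hAS : g A ≤ g S := hmono _ _ (Finset.erase_subset _ _)
  have hAM : g A ≤ M := hmono _ _ Finset.subset_union_left
  have hgain : g B - g A ≤ k * (M - g A) := calc
    g B - g A ≤ g (A ∪ B) - g A := sub_le_sub_right (hmono _ _ Finset.subset_union_right) _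
    _ ≤ ∑ b ∈ B, (g (A ∪ {b}) - g A) := submodular_union_sub_le_sum hsub hmono A B
    _ ≤ ∑ _b ∈ B, (M - g A) := Finset.sum_le_sum fun b _ => sub_le_sub_right (hvstar_max b) _
    _ = B.card * (M - g A) := by rw [Finset.sum_const, nsmul_eq_mul]
    _ ≤ k * (M - g A) :=
      mul_le_mul_of_nonneg_right (by exact_mod_cast hB) (sub_nonneg.2 hAM)
  have hloss : k * (g S - g A) ≤ g S := calc
    k * (g S - g A) = ∑ _e ∈ S, (g S - g A) := by rw [Finset.sum_const, nsmul_eq_mul, hS]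
    _ ≤ ∑ e ∈ S, (g S - g (S.erase e)) :=
      Finset.sum_le_sum fun e he => sub_le_sub_left (hestar_max e he) _
    _ ≤ g S - g (S \ S) := submodular_sum_sub_erase_le hsub S S
    _ ≤ g S := sub_le_self _ (hnn _)
  rw [one_div, inv_mul_le_iff₀ hk']
  linarith
end

section
/- Let H be a real Hilbert space, C ⊆ H a nonempty closed convex set, and let p, g ∈ H. Set q = π_C(p − g), the metric projection of p − g onto C. Then for every x ∈ C: 2⟨g, q − x⟩ ≤ ‖p − x‖² − ‖q − x‖² − ‖q − p‖². -/
open scoped RealInnerProductSpace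

/-- Let `H` be a real Hilbert space, `C` a nonempty closed
convex subset, `p, g ∈ H`, and `q = π_C(p − g)` the metric projection of
`p − g` onto `C` (characterized by `q ∈ C` and
`⟪(p − g) − q, w − q⟫ ≤ 0` for all `w ∈ C`). Then for every `x ∈ C`:
`2⟪g, q − x⟫ ≤ ‖p − x‖² − ‖q − x‖² − ‖q − p‖²`. -/
theorem projection_gradient_step_inequality
    (H : Type) [NormedAddCommGroup H] [InnerProductSpace ℝ H] [CompleteSpace H]
    (C : Set H) (hCne : C.Nonempty) (hCcl : IsClosed C) (hCconv : Convex ℝ C)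
    (p g q : H)
    (hq_mem : q ∈ C)
    (hq_proj : ∀ w ∈ C, ⟪(p - g) - q, w - q⟫ ≤ 0)
    (x : H) (hx : x ∈ C) :
    2 * ⟪g, q - x⟫ ≤ ‖p - x‖ ^ 2 - ‖q - x‖ ^ 2 - ‖q - p‖ ^ 2 := by
  have hproj := hq_proj x hx
  have hexpand : ‖p - x‖ ^ 2 = ‖q - p‖ ^ 2 + 2 * ⟪p - q, q - x⟫ + ‖q - x‖ ^ 2 := by
    rw [← sub_add_sub_cancel p q x, norm_add_sq_real, norm_sub_rev p q]
  rw [sub_right_comm, ← neg_sub q x, inner_neg_right, inner_sub_left] at hproj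
  linarith
end

section
/- Let H be a real Hilbert space, C ⊆ H a nonempty closed convex set, p ∈ H, γ > 0, and u, v ∈ H. Set q = π_C(p − γu) and r = π_C(p − γv). Suppose there are constants a, b ≥ 0 with ‖v − u‖ ≤ a·‖q − p‖ + b and γ·a ≤ 3/4. Then for every x ∈ C: 2γ⟨v, q − x⟩ ≤ ‖p − x‖² − ‖r − x‖² + 4γ²b². -/
open scoped RealInnerProductSpace

/-- Let `H` be a real Hilbert space, `C` nonempty closed
convex, `p ∈ H`, `γ > 0`, `u, v ∈ H`. Let `q = π_C(p − γu)` and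
`r = π_C(p − γv)` (each characterized by membership in `C` and the variational
inequality). Suppose `a, b ≥ 0` with `‖v − u‖ ≤ a·‖q − p‖ + b` and
`γ·a ≤ 3/4`. Then for every `x ∈ C`:
`2γ⟪v, q − x⟫ ≤ ‖p − x‖² − ‖r − x‖² + 4γ²b²`. -/
theorem extragradient_step_inequality
    (H : Type) [NormedAddCommGroup H] [InnerProductSpace ℝ H] [CompleteSpace H]
    (C : Set H) (hCne : C.Nonempty) (hCcl : IsClosed C) (hCconv : Convex ℝ C)
    (p : H) (γ : ℝ) (hγ : 0 < γ) (u v : H)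
    (q : H) (hq_mem : q ∈ C)
    (hq_proj : ∀ w ∈ C, ⟪(p - γ • u) - q, w - q⟫ ≤ 0)
    (r : H) (hr_mem : r ∈ C)
    (hr_proj : ∀ w ∈ C, ⟪(p - γ • v) - r, w - r⟫ ≤ 0)
    (a b : ℝ) (ha : 0 ≤ a) (hb : 0 ≤ b)
    (hvu : ‖v - u‖ ≤ a * ‖q - p‖ + b)
    (hγa : γ * a ≤ 3 / 4)
    (x : H) (hx : x ∈ C) :
    2 * γ * ⟪v, q - x⟫ ≤ ‖p - x‖ ^ 2 - ‖r - x‖ ^ 2 + 4 * γ ^ 2 * b ^ 2 := by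
  have hq := hq_proj r hr_mem
  have hr := hr_proj x hx
  have hcs : ⟪v - u, q - r⟫ ≤ ‖v - u‖ * ‖q - r‖ := real_inner_le_norm _ _
  have key : 2 * γ * ⟪v, q - x⟫ = ‖p - x‖ ^ 2 - ‖r - x‖ ^ 2 - ‖q - p‖ ^ 2 - ‖q - r‖ ^ 2
      + 2 * γ * ⟪v - u, q - r⟫ + 2 * ⟪(p - γ • u) - q, r - q⟫
      + 2 * ⟪(p - γ • v) - r, x - r⟫ := by
    simp only [← real_inner_self_eq_norm_sq, inner_sub_left, inner_sub_right,
      real_inner_smul_left]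
    rw [real_inner_comm p x, real_inner_comm p q, real_inner_comm q r,
      real_inner_comm r x]
    ring
  have hbound : γ * ‖v - u‖ ≤ 3 / 4 * ‖q - p‖ + γ * b := by
    nlinarith [mul_le_mul_of_nonneg_left hvu hγ.le,
      mul_le_mul_of_nonneg_right hγa (norm_nonneg (q - p))]
  have hsq : (γ * ‖v - u‖) ^ 2 ≤ (3 / 4 * ‖q - p‖ + γ * b) ^ 2 := by gcongr
  have hcs' := mul_le_mul_of_nonneg_left hcs hγ.le
  nlinarith [sq_nonneg (γ * ‖v - u‖ - ‖q - r‖), sq_nonneg (‖q - p‖ - 2 * (γ * b)),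
    sq_nonneg (γ * b), sq_nonneg ‖q - p‖]
end

section
/- (Gradient Greedy convergence.) Let V be a finite set, k a positive integer, X ⊆ ℝ^d nonempty, closed, and convex, x₁ ∈ X, and H > 0 with ‖x − x₁‖² ≤ H for all x ∈ X. Let f : ℝ^d × 2^V → [0, ∞) be such that for every S ⊆ V with |S| ≤ k the map f(·, S) is convex and differentiable, its gradient satisfies ‖∇ₓ f(x, S)‖ ≤ M for all x, and ∇ₓ f(·, S) is L-Lipschitz. Let T be a positive integer with √T ≥ L and set γ = 1/√T. Suppose points x₁, …, x_{T+1} ∈ X and sets S₁, …, S_T ⊆ V with |S_t| ≤ k satisfy, for every 1 ≤ t ≤ T: (i) (1 − 1/e)·f(x_t, S) ≤ f(x_t, S_t) for every S ⊆ V with |S| ≤ k; and (ii) x_{t+1} = π_X(x_t − γ ∇ₓ f(x_t, S_t)). Then, with x̄ = (1/T) ∑_{t=1}^T x_t: (1 − 1/e) · max_{|S| ≤ k} f(x̄, S) ≤ min_{x ∈ X} max_{|S| ≤ k} f(x, S) + (2M² + H/2)/√T. -/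
open scoped RealInnerProductSpace

/-- `maxCard k g` is the maximum of `g S` over all `S ⊆ V` with `|S| ≤ k`. -/
noncomputable def maxCard {V : Type} [Fintype V] [DecidableEq V] (k : ℕ)
    (g : Finset V → ℝ) : ℝ :=
  ((Finset.univ : Finset (Finset V)).filter (fun S => S.card ≤ k)).sup'
    ⟨∅, by simp⟩ g

/-- First-order characterization of convexity: a convex function lies above its tangent planes. -/
theorem ConvexOn.inner_gradient_le_sub {E : Type*} [NormedAddCommGroup E] [InnerProductSpace ℝ E]
    [CompleteSpace E] {f : E → ℝ} (hf : ConvexOn ℝ Set.univ f) {x g : E}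
    (hg : HasGradientAt f g x) (z : E) : ⟪g, z - x⟫ ≤ f z - f x := by
  have hc : ConvexOn ℝ Set.univ (f ∘ AffineMap.lineMap (k := ℝ) x z) := by
    simpa using hf.comp_affineMap (AffineMap.lineMap (k := ℝ) x z)
  have hd : HasDerivAt (f ∘ AffineMap.lineMap (k := ℝ) x z) ⟪g, z - x⟫ 0 := by
    have h : HasFDerivAt f (InnerProductSpace.toDual ℝ E g) (AffineMap.lineMap (k := ℝ) x z 0) := by
      simpa using hg.hasFDerivAt
    simpa using h.comp_hasDerivAt (0 : ℝ) AffineMap.hasDerivAt_lineMap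
  have h := hc.le_slope_of_hasDerivAt (Set.mem_univ 0) (Set.mem_univ 1) one_pos hd
  simpa [slope_def_field] using h

/-- One step of projected gradient descent: `p` is the projection of `y - γ • g`, tested
against the point `z`. -/
theorem two_mul_inner_le_of_projected_step {E : Type*} [NormedAddCommGroup E]
    [InnerProductSpace ℝ E] {y g p z : E} {γ : ℝ} (h : ⟪(y - γ • g) - p, z - p⟫ ≤ 0) :
    2 * γ * ⟪g, y - z⟫ ≤ ‖z - y‖ ^ 2 - ‖z - p‖ ^ 2 + γ ^ 2 * ‖g‖ ^ 2 := by
  have h1 := norm_sub_sq_real (z - p) ((y - γ • g) - p)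
  have h2 : (z - p) - ((y - γ • g) - p) = (z - y) + γ • g := by abel
  have h3 := norm_add_sq_real (z - y) (γ • g)
  rw [real_inner_comm] at h
  rw [h2, h3, inner_smul_right, norm_smul, mul_pow, Real.norm_eq_abs, sq_abs, real_inner_comm,
    ← neg_sub y z, inner_neg_right, norm_neg] at h1
  rw [← neg_sub y z, norm_neg]
  nlinarith [sq_nonneg ‖y - γ • g - p‖]

/-- (Gradient Greedy convergence.) Under smoothness, bounded
gradients, convexity in `x`, the `(1 − 1/e)` greedy guarantee for each `S_t`,
and projected gradient updates with step `γ = 1/√T`, the averaged iterate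
`x̄ = (1/T)∑ x_t` satisfies
`(1 − 1/e)·max_{|S|≤k} f(x̄,S) ≤ min_{x∈X} max_{|S|≤k} f(x,S) + (2M² + H/2)/√T`. -/
theorem gradient_greedy_convergence
    {d : ℕ} (V : Type) [Fintype V] [DecidableEq V] (k : ℕ) (hk : 0 < k)
    (X : Set (EuclideanSpace ℝ (Fin d))) (hXne : X.Nonempty)
    (hXcl : IsClosed X) (hXconv : Convex ℝ X)
    (H M L : ℝ) (hH : 0 < H)
    (f : EuclideanSpace ℝ (Fin d) → Finset V → ℝ)
    (gradf : EuclideanSpace ℝ (Fin d) → Finset V → EuclideanSpace ℝ (Fin d))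
    (hf_nonneg : ∀ x S, 0 ≤ f x S)
    (hconv : ∀ S : Finset V, S.card ≤ k → ConvexOn ℝ Set.univ (fun x => f x S))
    (hgrad : ∀ S : Finset V, S.card ≤ k →
      ∀ x, HasGradientAt (fun y => f y S) (gradf x S) x)
    (hM : ∀ x, ∀ S : Finset V, S.card ≤ k → ‖gradf x S‖ ≤ M)
    (hL : ∀ S : Finset V, S.card ≤ k →
      ∀ x x', ‖gradf x' S - gradf x S‖ ≤ L * ‖x' - x‖)
    (T : ℕ) (hT : 0 < T) (hTL : L ≤ Real.sqrt T)
    (γ : ℝ) (hγ : γ = 1 / Real.sqrt T)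
    (x : ℕ → EuclideanSpace ℝ (Fin d)) (S : ℕ → Finset V)
    (hx1 : x 1 ∈ X)
    (hbound : ∀ z ∈ X, ‖z - x 1‖ ^ 2 ≤ H)
    (hcard : ∀ t, 1 ≤ t → t ≤ T → (S t).card ≤ k)
    (hgreedy : ∀ t, 1 ≤ t → t ≤ T → ∀ S' : Finset V, S'.card ≤ k →
      (1 - 1 / Real.exp 1) * f (x t) S' ≤ f (x t) (S t))
    (hproj_mem : ∀ t, 1 ≤ t → t ≤ T → x (t + 1) ∈ X)
    (hproj : ∀ t, 1 ≤ t → t ≤ T → ∀ w ∈ X,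
      ⟪(x t - γ • gradf (x t) (S t)) - x (t + 1), w - x (t + 1)⟫ ≤ 0)
    (xbar : EuclideanSpace ℝ (Fin d))
    (hxbar : xbar = (1 / (T : ℝ)) • ∑ t ∈ Finset.Icc 1 T, x t) :
    (1 - 1 / Real.exp 1) * maxCard k (f xbar) ≤
      sInf ((fun z => maxCard k (f z)) '' X) + (2 * M ^ 2 + H / 2) / Real.sqrt T := by
  have hsT : 0 < Real.sqrt T := Real.sqrt_pos.2 (by exact_mod_cast hT)
  have hTpos : (0 : ℝ) < T := by exact_mod_cast hT
  have hsq : Real.sqrt T * Real.sqrt T = T := Real.mul_self_sqrt hTpos.le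
  have hγpos : 0 < γ := hγ ▸ one_div_pos.2 hsT
  have he : 0 ≤ 1 - 1 / Real.exp 1 := by
    rw [sub_nonneg, div_le_one (Real.exp_pos 1)]
    exact Real.one_le_exp zero_le_one
  rw [← sub_le_iff_le_add]
  refine le_csInf (hXne.image _) ?_
  rintro _ ⟨z, hz, rfl⟩
  rw [sub_le_iff_le_add]
  obtain ⟨R, hR, hmax⟩ := Finset.exists_mem_eq_sup'
    (s := (Finset.univ : Finset (Finset V)).filter (fun S => S.card ≤ k)) ⟨∅, by simp⟩ (f xbar)
  have hRk : R.card ≤ k := (Finset.mem_filter.1 hR).2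
  have hmaxR : maxCard k (f xbar) = f xbar R := hmax
  have hjensen : T * f xbar R ≤ ∑ t ∈ Finset.Icc 1 T, f (x t) R := by
    have h := (hconv R hRk).map_sum_le (t := Finset.Icc 1 T) (w := fun _ => 1 / (T : ℝ)) (p := x)
      (fun _ _ => by positivity) (by simp [hTpos.ne']) (fun _ _ => Set.mem_univ _)
    simp only [smul_eq_mul, ← Finset.smul_sum, ← Finset.mul_sum, ← hxbar] at h
    rwa [one_div, ← div_eq_inv_mul, le_div_iff₀' hTpos] at h
  have hstep : ∀ t ∈ Finset.Icc 1 T, 2 * γ * ((1 - 1 / Real.exp 1) * f (x t) R) ≤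
      (‖z - x t‖ ^ 2 - ‖z - x (t + 1)‖ ^ 2) + (γ ^ 2 * M ^ 2 + 2 * γ * maxCard k (f z)) := by
    intro t ht
    obtain ⟨h1, h2⟩ := Finset.mem_Icc.1 ht
    have hSt := hcard t h1 h2
    have hdescent := two_mul_inner_le_of_projected_step (hproj t h1 h2 z hz)
    have htangent := (hconv (S t) hSt).inner_gradient_le_sub (hgrad (S t) hSt (x t)) z
    rw [← neg_sub (x t) z, inner_neg_right] at htangent
    have hle : f z (S t) ≤ maxCard k (f z) :=
      Finset.le_sup' (f z) (Finset.mem_filter.2 ⟨Finset.mem_univ _, hSt⟩)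
    have hgM : γ ^ 2 * ‖gradf (x t) (S t)‖ ^ 2 ≤ γ ^ 2 * M ^ 2 := by
      gcongr
      exact hM _ _ hSt
    have hvalue : (1 - 1 / Real.exp 1) * f (x t) R ≤
        maxCard k (f z) + ⟪gradf (x t) (S t), x t - z⟫ := by
      linarith [hgreedy t h1 h2 R hRk]
    linarith [mul_le_mul_of_nonneg_left hvalue (by positivity : 0 ≤ 2 * γ)]
  have htel : ∑ t ∈ Finset.Icc 1 T, (‖z - x t‖ ^ 2 - ‖z - x (t + 1)‖ ^ 2) ≤ H := by
    rw [← Finset.Ico_add_one_right_eq_Icc,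
      Finset.sum_Ico_eq_sum_range]
    have h := Finset.sum_range_sub' (fun i => ‖z - x (1 + i)‖ ^ 2) T
    simp only [add_tsub_cancel_right, ← add_assoc, add_zero] at h ⊢
    rw [h]
    linarith [hbound z hz, sq_nonneg ‖z - x (1 + T)‖]
  have hsum := Finset.sum_le_sum hstep
  rw [Finset.sum_add_distrib, ← Finset.mul_sum, ← Finset.mul_sum, Finset.sum_const,
    Nat.card_Icc, Nat.add_sub_cancel, nsmul_eq_mul] at hsum
  have hγT : γ * T = Real.sqrt T := by
    rw [hγ]
    nth_rewrite 2 [← hsq]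
    field_simp
  have hγ2T : γ ^ 2 * T = 1 := by
    rw [hγ, div_pow, Real.sq_sqrt hTpos.le]
    field_simp
  have hlower : 2 * γ * ((1 - 1 / Real.exp 1) * (T * f xbar R)) ≤
      2 * γ * ((1 - 1 / Real.exp 1) * ∑ t ∈ Finset.Icc 1 T, f (x t) R) := by
    gcongr
  have hmain : Real.sqrt T * ((1 - 1 / Real.exp 1) * f xbar R) ≤
      Real.sqrt T * maxCard k (f z) + (2 * M ^ 2 + H / 2) := by
    have e1 : 2 * γ * ((1 - 1 / Real.exp 1) * (T * f xbar R)) =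
        2 * (Real.sqrt T * ((1 - 1 / Real.exp 1) * f xbar R)) := by
      rw [← hγT]
      ring
    have e2 : (T : ℝ) * (γ ^ 2 * M ^ 2 + 2 * γ * maxCard k (f z)) =
        M ^ 2 + 2 * (Real.sqrt T * maxCard k (f z)) := by
      linear_combination M ^ 2 * hγ2T + 2 * maxCard k (f z) * hγT
    nlinarith [sq_nonneg M]
  rw [hmaxR, ← mul_le_mul_iff_right₀ hsT, mul_add, mul_div_cancel₀ _ hsT.ne']
  exact hmain
end

section
/- (Extra-Gradient Greedy convergence.) Let V be a finite set, k a positive integer, X ⊆ ℝ^d nonempty, closed, and convex, x₁ ∈ X, and H > 0 with ‖x − x₁‖² ≤ H for all x ∈ X. Let f : ℝ^d × 2^V → [0, ∞) be such that for every S ⊆ V with |S| ≤ k the map f(·, S) is convex and differentiable, and suppose there are constants a, b ≥ 0 such that ‖∇ₓ f(x', S') − ∇ₓ f(x, S)‖ ≤ a·‖x' − x‖ + b for all x, x' ∈ ℝ^d and all S, S' ⊆ V with |S|, |S'| ≤ k. Let T be a positive integer, set γ = 1/√T, and assume γ·a ≤ 3/4. Suppose points x₁, …, x_{T+1} ∈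 X, auxiliary points x̂₁, …, x̂_T, and sets S_t, Ŝ_t ⊆ V with |S_t| ≤ k, |Ŝ_t| ≤ k satisfy, for every 1 ≤ t ≤ T: (i) x̂_t = π_X(x_t − γ ∇ₓ f(x_t, S_t)); (ii) (1 − 1/e)·f(x̂_t, S) ≤ f(x̂_t, Ŝ_t) for every S ⊆ V with |S| ≤ k; (iii) x_{t+1} = π_X(x_t − γ ∇ₓ f(x̂_t, Ŝ_t)). Then, with x̄ = (1/T) ∑_{t=1}^T x̂_t: (1 − 1/e) · max_{|S| ≤ k} f(x̄, S) ≤ min_{x ∈ X} max_{|S| ≤ k} f(x, S) + (H/2 + 2b²)/√T. -/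
open scoped RealInnerProductSpace

/-- First-order condition for convexity: a convex function lies above its tangent hyperplanes. -/
lemma ConvexOn.sub_le_inner_of_hasGradientAt {E : Type*} [NormedAddCommGroup E]
    [InnerProductSpace ℝ E] [CompleteSpace E] {φ : E → ℝ} {g x : E}
    (hφ : ConvexOn ℝ Set.univ φ) (hg : HasGradientAt φ g x) (y : E) :
    φ x - φ y ≤ ⟪g, x - y⟫ := by
  have hconv : ConvexOn ℝ Set.univ (φ ∘ AffineMap.lineMap (k := ℝ) x y) := by
    simpa using hφ.comp_affineMap (AffineMap.lineMap (k := ℝ) x y)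
  have hline : HasDerivAt (AffineMap.lineMap (k := ℝ) x y) (y - x) (0 : ℝ) :=
    AffineMap.hasDerivAt_lineMap
  have hderiv : HasDerivAt (φ ∘ AffineMap.lineMap (k := ℝ) x y) ⟪g, y - x⟫ (0 : ℝ) := by
    have hfd : HasFDerivAt φ (InnerProductSpace.toDual ℝ E g)
        (AffineMap.lineMap (k := ℝ) x y (0 : ℝ)) := by
      simpa using hg.hasFDerivAt
    simpa using hfd.comp_hasDerivAt (0 : ℝ) hline
  have hslope := hconv.le_slope_of_hasDerivAt (Set.mem_univ 0) (Set.mem_univ 1) one_pos hderiv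
  simp only [slope_def_field, Function.comp_apply, AffineMap.lineMap_apply_zero,
    AffineMap.lineMap_apply_one, sub_zero, div_one] at hslope
  rw [← neg_sub y x, inner_neg_right]
  linarith

/-- One step of the extra-gradient method from `x`, with trial point `q` and new iterate `r`,
where `g₀` and `g₁` are the gradients used for the trial and the actual step. -/
lemma extraGradient_step {E : Type*} [NormedAddCommGroup E] [InnerProductSpace ℝ E]
    {x q r w g₀ g₁ : E} {γ a b : ℝ} (hγ : 0 ≤ γ) (hγa : γ * a ≤ 3 / 4)
    (hg : ‖g₁ - g₀‖ ≤ a * ‖q - x‖ + b)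
    (hq : ⟪x - γ • g₀ - q, r - q⟫ ≤ 0) (hr : ⟪x - γ • g₁ - r, w - r⟫ ≤ 0) :
    2 * (γ * ⟪g₁, q - w⟫) ≤ ‖w - x‖ ^ 2 - ‖w - r‖ ^ 2 + 4 * (γ * b) ^ 2 := by
  obtain ⟨u, rfl⟩ : ∃ u, q = x + u := ⟨q - x, by abel⟩
  obtain ⟨v, rfl⟩ : ∃ v, r = x + u + v := ⟨r - (x + u), by abel⟩
  obtain ⟨z, rfl⟩ : ∃ z, w = x + u + v + z := ⟨w - (x + u + v), by abel⟩
  rw [show x - γ • g₀ - (x + u) = -(u + γ • g₀) by abel, add_sub_cancel_left, inner_neg_left,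
    inner_add_left, real_inner_smul_left] at hq
  rw [show x - γ • g₁ - (x + u + v) = -(u + v + γ • g₁) by abel, add_sub_cancel_left,
    inner_neg_left, inner_add_left, real_inner_smul_left] at hr
  rw [add_sub_cancel_left] at hg
  rw [show x + u - (x + u + v + z) = -(v + z) by abel,
    show x + u + v + z - x = u + v + z by abel, add_sub_cancel_left, inner_neg_right,
    inner_add_right, norm_add_sq_real (u + v) z, norm_add_sq_real u v]
  have hcross : γ * (⟪g₀, v⟫ - ⟪g₁, v⟫) ≤ γ * ((a * ‖u‖ + b) * ‖v‖) := by
    refine mul_le_mul_of_nonneg_left ?_ hγ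
    have h := real_inner_le_norm (g₀ - g₁) v
    rw [norm_sub_rev, inner_sub_left] at h
    exact h.trans (mul_le_mul_of_nonneg_right hg (norm_nonneg v))
  have huv : γ * a * (‖u‖ * ‖v‖) ≤ 3 / 4 * (‖u‖ * ‖v‖) :=
    mul_le_mul_of_nonneg_right hγa (by positivity)
  nlinarith [sq_nonneg (‖u‖ - 3 / 4 * ‖v‖), sq_nonneg (‖v‖ / 2 - 2 * (γ * b)),
    sq_nonneg ‖v‖]

lemma le_maxCard {V : Type} [Fintype V] [DecidableEq V] {k : ℕ} (g : Finset V → ℝ)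
    {S : Finset V} (hS : S.card ≤ k) : g S ≤ maxCard k g :=
  Finset.le_sup' g (by simpa using hS)

lemma exists_maxCard_eq {V : Type} [Fintype V] [DecidableEq V] (k : ℕ) (g : Finset V → ℝ) :
    ∃ S : Finset V, S.card ≤ k ∧ maxCard k g = g S := by
  obtain ⟨S, hS, h⟩ := Finset.exists_mem_eq_sup'
    (s := (Finset.univ : Finset (Finset V)).filter (fun S => S.card ≤ k)) ⟨∅, by simp⟩ g
  exact ⟨S, by simpa using hS, h⟩

/-- (Extra-Gradient Greedy convergence.) Under convexity in
`x`, the gradient-variation bound `‖∇f(x',S') − ∇f(x,S)‖ ≤ a‖x'−x‖ + b`,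
the `(1 − 1/e)` greedy guarantee at the auxiliary points, and extra-gradient
updates with step `γ = 1/√T` with `γa ≤ 3/4`, the averaged auxiliary iterate
`x̄ = (1/T)∑ x̂_t` satisfies
`(1 − 1/e)·max_{|S|≤k} f(x̄,S) ≤ min_{x∈X} max_{|S|≤k} f(x,S) + (H/2 + 2b²)/√T`. -/
theorem extra_gradient_greedy_convergence
    {d : ℕ} (V : Type) [Fintype V] [DecidableEq V] (k : ℕ) (hk : 0 < k)
    (X : Set (EuclideanSpace ℝ (Fin d))) (hXne : X.Nonempty)
    (hXcl : IsClosed X) (hXconv : Convex ℝ X)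
    (H : ℝ) (hH : 0 < H)
    (f : EuclideanSpace ℝ (Fin d) → Finset V → ℝ)
    (gradf : EuclideanSpace ℝ (Fin d) → Finset V → EuclideanSpace ℝ (Fin d))
    (hf_nonneg : ∀ x S, 0 ≤ f x S)
    (hconv : ∀ S : Finset V, S.card ≤ k → ConvexOn ℝ Set.univ (fun x => f x S))
    (hgrad : ∀ S : Finset V, S.card ≤ k →
      ∀ x, HasGradientAt (fun y => f y S) (gradf x S) x)
    (a b : ℝ) (ha : 0 ≤ a) (hb : 0 ≤ b)
    (hab : ∀ x x' : EuclideanSpace ℝ (Fin d), ∀ S S' : Finset V,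
      S.card ≤ k → S'.card ≤ k →
      ‖gradf x' S' - gradf x S‖ ≤ a * ‖x' - x‖ + b)
    (T : ℕ) (hT : 0 < T)
    (γ : ℝ) (hγ : γ = 1 / Real.sqrt T) (hγa : γ * a ≤ 3 / 4)
    (x xhat : ℕ → EuclideanSpace ℝ (Fin d)) (S Shat : ℕ → Finset V)
    (hx1 : x 1 ∈ X)
    (hbound : ∀ z ∈ X, ‖z - x 1‖ ^ 2 ≤ H)
    (hcardS : ∀ t, 1 ≤ t → t ≤ T → (S t).card ≤ k)
    (hcardShat : ∀ t, 1 ≤ t → t ≤ T → (Shat t).card ≤ k)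
    (hxhat_mem : ∀ t, 1 ≤ t → t ≤ T → xhat t ∈ X)
    (hxhat_proj : ∀ t, 1 ≤ t → t ≤ T → ∀ w ∈ X,
      ⟪(x t - γ • gradf (x t) (S t)) - xhat t, w - xhat t⟫ ≤ 0)
    (hgreedy : ∀ t, 1 ≤ t → t ≤ T → ∀ S' : Finset V, S'.card ≤ k →
      (1 - 1 / Real.exp 1) * f (xhat t) S' ≤ f (xhat t) (Shat t))
    (hproj_mem : ∀ t, 1 ≤ t → t ≤ T → x (t + 1) ∈ X)
    (hproj : ∀ t, 1 ≤ t → t ≤ T → ∀ w ∈ X,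
      ⟪(x t - γ • gradf (xhat t) (Shat t)) - x (t + 1), w - x (t + 1)⟫ ≤ 0)
    (xbar : EuclideanSpace ℝ (Fin d))
    (hxbar : xbar = (1 / (T : ℝ)) • ∑ t ∈ Finset.Icc 1 T, xhat t) :
    (1 - 1 / Real.exp 1) * maxCard k (f xbar) ≤
      sInf ((fun z => maxCard k (f z)) '' X) + (H / 2 + 2 * b ^ 2) / Real.sqrt T := by
  have hT' : (0 : ℝ) < T := by exact_mod_cast hT
  have hγ0 : 0 < γ := by rw [hγ]; positivity
  have hγT : γ ^ 2 * T = 1 := by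
    rw [hγ, div_pow, Real.sq_sqrt hT'.le]
    field_simp
  have hc : 0 ≤ 1 - 1 / Real.exp 1 := by
    rw [sub_nonneg, div_le_one (Real.exp_pos 1)]
    exact Real.one_le_exp zero_le_one
  rw [← sub_le_iff_le_add]
  refine le_csInf (hXne.image _) ?_
  rintro _ ⟨w, hw, rfl⟩
  rw [sub_le_iff_le_add]
  obtain ⟨S', hS', hmax⟩ := exists_maxCard_eq k (f xbar)
  rw [hmax]
  have hjensen : T * f xbar S' ≤ ∑ t ∈ Finset.Icc 1 T, f (xhat t) S' := by
    have h := (hconv S' hS').map_sum_le (t := Finset.Icc 1 T) (w := fun _ => 1 / (T : ℝ))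
      (p := xhat) (fun _ _ => by positivity) (by simp [hT'.ne']) (fun _ _ => Set.mem_univ _)
    rw [← Finset.smul_sum, ← hxbar, ← Finset.smul_sum, smul_eq_mul] at h
    rwa [one_div_mul_eq_div, le_div_iff₀' hT'] at h
  have hstep : ∀ t ∈ Finset.Icc 1 T,
      2 * γ * ((1 - 1 / Real.exp 1) * f (xhat t) S' - maxCard k (f w)) ≤
        (‖w - x t‖ ^ 2 - ‖w - x (t + 1)‖ ^ 2) + 4 * (γ * b) ^ 2 := by
    intro t ht
    obtain ⟨h1, h2⟩ := Finset.mem_Icc.mp ht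
    have hcS := hcardShat t h1 h2
    have hfirst := (hconv _ hcS).sub_le_inner_of_hasGradientAt (hgrad _ hcS (xhat t)) w
    have hle : (1 - 1 / Real.exp 1) * f (xhat t) S' - maxCard k (f w) ≤
        ⟪gradf (xhat t) (Shat t), xhat t - w⟫ := by
      linarith [hgreedy t h1 h2 S' hS', le_maxCard (f w) hcS]
    have hstep := extraGradient_step hγ0.le hγa
      (hab (x t) (xhat t) (S t) (Shat t) (hcardS t h1 h2) hcS)
      (hxhat_proj t h1 h2 _ (hproj_mem t h1 h2)) (hproj t h1 h2 w hw)
    linarith [mul_le_mul_of_nonneg_left hle hγ0.le]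
  have htele : ∑ t ∈ Finset.Icc 1 T, (‖w - x t‖ ^ 2 - ‖w - x (t + 1)‖ ^ 2) =
      ‖w - x 1‖ ^ 2 - ‖w - x (T + 1)‖ ^ 2 := by
    have h := Finset.sum_Ico_sub (fun t => ‖w - x t‖ ^ 2) (show 1 ≤ T + 1 by omega)
    rw [← neg_inj, ← Finset.sum_neg_distrib, neg_sub, ← h]
    exact Finset.sum_congr rfl fun _ _ => neg_sub _ _
  have hsum := Finset.sum_le_sum hstep
  rw [← Finset.mul_sum, Finset.sum_sub_distrib, ← Finset.mul_sum, Finset.sum_add_distrib, htele]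
    at hsum
  simp only [Finset.sum_const, Nat.card_Icc, add_tsub_cancel_right, nsmul_eq_mul] at hsum
  have hregret : 2 * γ * (T * ((1 - 1 / Real.exp 1) * f xbar S' - maxCard k (f w))) ≤
      H + 4 * b ^ 2 := by
    have hscaled := mul_le_mul_of_nonneg_left (mul_le_mul_of_nonneg_left hjensen hc)
      (show 0 ≤ 2 * γ by positivity)
    have hnoise : T * (4 * (γ * b) ^ 2) = 4 * b ^ 2 := by linear_combination 4 * b ^ 2 * hγT
    linarith [hbound w hw, sq_nonneg ‖w - x (T + 1)‖]
  have hfinal : γ * (2 * γ * (T * ((1 - 1 / Real.exp 1) * f xbar S' - maxCard k (f w)))) =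
      2 * ((1 - 1 / Real.exp 1) * f xbar S' - maxCard k (f w)) := by
    linear_combination 2 * ((1 - 1 / Real.exp 1) * f xbar S' - maxCard k (f w)) * hγT
  have hrate : (H / 2 + 2 * b ^ 2) / Real.sqrt T = γ * (H / 2 + 2 * b ^ 2) := by
    rw [hγ, one_div_mul_eq_div]
  rw [hrate]
  linarith [mul_le_mul_of_nonneg_left hregret hγ0.le]
end

section
/- (Gradient Replacement-Greedy convergence.) Let V be a finite set, k ≥ 2 an integer, X ⊆ ℝ^d nonempty, closed, and convex, x₁ ∈ X, and H > 0 with ‖x − x₁‖² ≤ H for all x ∈ X. Let f : ℝ^d × 2^V → [0, ∞) be such that for every S ⊆ V with |S| ≤ k the map f(·, S) is convex and differentiable, ‖∇ₓ f(x, S)‖ ≤ M for all x, and ∇ₓ f(·, S) is L-Lipschitz; let A ≥ 0 satisfy f(x₁, S) ≤ A for all S with |S| ≤ k. Let T be a positive integer with √T ≥ L and set γ = 1/√T. Suppose points x₁, …, x_{T+1} ∈ X and sets S₁, …, S_{T+1} ⊆ V with |S_t| ≤ k satisfy, for every 1 ≤ t ≤ T: (i) x_{t+1} = π_X(x_t −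 γ ∇ₓ f(x_t, S_t)); and (ii) f(x_{t+1}, S_{t+1}) − f(x_{t+1}, S_t) ≥ (1/k)·( f(x_{t+1}, S) − 2 f(x_{t+1}, S_t) ) for every S ⊆ V with |S| ≤ k. Then, with x̄ = (1/T) ∑_{t=1}^T x_t: (1/2) · max_{|S| ≤ k} f(x̄, S) ≤ min_{x ∈ X} max_{|S| ≤ k} f(x, S) + H/(2√T) + A/(2T(1 − e^{−2/k})) + M²(1 + k)/√T. -/
open scoped RealInnerProductSpace

/-- First-order characterization of convexity: a convex function lies above its tangents. -/
lemma ConvexOn.add_inner_gradient_le {E : Type*} [NormedAddCommGroup E] [InnerProductSpace ℝ E]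
    [CompleteSpace E] {φ : E → ℝ} {g x : E} (hφ : ConvexOn ℝ Set.univ φ)
    (hg : HasGradientAt φ g x) (y : E) : φ x + ⟪g, y - x⟫ ≤ φ y := by
  have hline : ConvexOn ℝ Set.univ (fun s : ℝ => φ (AffineMap.lineMap x y s)) :=
    hφ.comp_affineMap (AffineMap.lineMap x y)
  have hderiv : HasDerivAt (fun s : ℝ => φ (AffineMap.lineMap x y s)) ⟪g, y - x⟫ 0 := by
    have hx : HasFDerivAt φ (InnerProductSpace.toDual ℝ E g) (AffineMap.lineMap x y (0 : ℝ)) := by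
      simpa using hg.hasFDerivAt
    simpa [Function.comp_def] using hx.comp_hasDerivAt (0 : ℝ) AffineMap.hasDerivAt_lineMap
  have hslope := hline.le_slope_of_hasDerivAt (Set.mem_univ 0) (Set.mem_univ 1) one_pos hderiv
  simp only [slope_def_field, AffineMap.lineMap_apply_zero, AffineMap.lineMap_apply_one, sub_zero,
    div_one] at hslope
  linarith

/-- A convex differentiable function with gradient bounded by `M` is `M`-Lipschitz. -/
lemma ConvexOn.abs_sub_le_of_norm_gradient_le {E : Type*} [NormedAddCommGroup E]
    [InnerProductSpace ℝ E] [CompleteSpace E] {φ : E → ℝ} {g : E → E} {M : ℝ}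
    (hφ : ConvexOn ℝ Set.univ φ) (hg : ∀ x, HasGradientAt φ (g x) x) (hM : ∀ x, ‖g x‖ ≤ M)
    (x y : E) : |φ x - φ y| ≤ M * ‖x - y‖ := by
  have key (u v : E) : φ u - φ v ≤ M * ‖u - v‖ := by
    have h₁ := hφ.add_inner_gradient_le (hg u) v
    have h₂ : ⟪g u, u - v⟫ ≤ M * ‖u - v‖ := (real_inner_le_norm _ _).trans (by gcongr; exact hM u)
    rw [← neg_sub u v, inner_neg_right] at h₁
    linarith
  refine abs_le.2 ⟨?_, key x y⟩
  linarith [norm_sub_rev x y ▸ key y x]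

/-- If `p` is the projection of `x - v` and `x` is feasible, then `p` is within `‖v‖` of `x`. -/
lemma norm_sub_le_of_inner_sub_le_zero {E : Type*} [NormedAddCommGroup E]
    [InnerProductSpace ℝ E] {x v p : E} (h : ⟪x - v - p, x - p⟫ ≤ 0) : ‖p - x‖ ≤ ‖v‖ := by
  rw [norm_sub_rev]
  rw [sub_right_comm, inner_sub_left, real_inner_self_eq_norm_sq] at h
  by_contra! hlt
  nlinarith [real_inner_le_norm v (x - p), norm_nonneg v]

/-- One step of projected gradient descent: the distance to a feasible point `z`. -/
lemma two_mul_inner_le_of_inner_sub_le_zero {E : Type*} [NormedAddCommGroup E]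
    [InnerProductSpace ℝ E] {x v p z : E} (h : ⟪x - v - p, z - p⟫ ≤ 0) :
    2 * ⟪v, x - z⟫ ≤ ‖x - z‖ ^ 2 - ‖p - z‖ ^ 2 + ‖v‖ ^ 2 := by
  have h₁ : ⟪p - z, p - z⟫ ≤ ⟪x - z - v, p - z⟫ := by
    rw [← sub_nonpos, ← inner_sub_left, ← neg_sub z p, inner_neg_right, ← inner_neg_left]
    convert h using 2
    abel
  have h₂ := norm_sub_sq_real (x - z - v) (p - z)
  have h₃ := norm_sub_sq_real (x - z) v
  rw [real_inner_self_eq_norm_sq] at h₁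
  rw [real_inner_comm]
  nlinarith [sq_nonneg ‖x - z - v - (p - z)‖]

/-- Regret bound for projected gradient steps with linear losses. -/
lemma two_mul_sum_inner_le_of_projected_steps {E : Type*} [NormedAddCommGroup E]
    [InnerProductSpace ℝ E] {y v : ℕ → E} {z : E} {B : ℝ} (T : ℕ)
    (hstep : ∀ t < T, ⟪y t - v t - y (t + 1), z - y (t + 1)⟫ ≤ 0)
    (hv : ∀ t < T, ‖v t‖ ≤ B) :
    2 * ∑ t ∈ Finset.range T, ⟪v t, y t - z⟫ ≤ ‖y 0 - z‖ ^ 2 + T * B ^ 2 := by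
  have hterm : ∀ t ∈ Finset.range T,
      2 * ⟪v t, y t - z⟫ ≤ (‖y t - z‖ ^ 2 - ‖y (t + 1) - z‖ ^ 2) + B ^ 2 := by
    intro t ht
    have hB : ‖v t‖ ^ 2 ≤ B ^ 2 := by
      gcongr
      exact hv t (Finset.mem_range.1 ht)
    linarith [two_mul_inner_le_of_inner_sub_le_zero (hstep t (Finset.mem_range.1 ht))]
  have hsum := Finset.sum_le_sum hterm
  rw [← Finset.mul_sum, Finset.sum_add_distrib, Finset.sum_range_sub', Finset.sum_const,
    Finset.card_range, nsmul_eq_mul] at hsum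
  linarith [sq_nonneg ‖y T - z‖]

/-- Partial sums of a sequence contracted by `q` up to an additive error `δ`. -/
lemma sum_range_le_of_le_mul_add {q δ : ℝ} (hq₀ : 0 ≤ q) (hq₁ : q ≤ 1) (hδ : 0 ≤ δ) (T : ℕ) :
    ∀ {a : ℕ → ℝ} {c : ℝ}, 0 ≤ c → a 0 ≤ c → (∀ t < T, a (t + 1) ≤ q * (a t + δ)) →
      (1 - q) * ∑ t ∈ Finset.range T, a t ≤ c + T * (q * δ) := by
  induction T with
  | zero => intro a c hc _ _; simpa using hc
  | succ T ih =>
    intro a c hc ha hstep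
    have h₀ : a 1 ≤ q * (c + δ) := (hstep 0 T.succ_pos).trans (by gcongr)
    have h₁ := ih (a := fun t => a (t + 1)) (by positivity) h₀
      fun t ht => hstep (t + 1) (by omega)
    rw [Finset.sum_range_succ']
    push_cast
    nlinarith [mul_le_mul_of_nonneg_left ha (sub_nonneg.2 hq₁)]

/-- The greedy gap decays geometrically, up to the drift caused by moving the point. -/
lemma half_sub_le_of_exchange {k p p' r r' s D : ℝ} (hk : 2 ≤ k)
    (hexch : 1 / k * (p' - 2 * r') ≤ s - r') (hp : p' - p ≤ D) (hr : r - r' ≤ D) :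
    1 / 2 * p' - s ≤ (1 - 2 / k) * (1 / 2 * p - r + 3 / 2 * D) := by
  have hq : 0 ≤ 1 - 2 / k := sub_nonneg.2 ((div_le_one (by linarith)).2 hk)
  calc 1 / 2 * p' - s ≤ (1 - 2 / k) * (1 / 2 * p' - r') := by
        linear_combination hexch
    _ ≤ (1 - 2 / k) * (1 / 2 * p - r + 3 / 2 * D) := by
        gcongr
        linarith

/-- Averaging the regret and greedy-gap bounds. -/
lemma average_bounds_le {k T A H M R G : ℝ} (hk : 2 ≤ k) (hT : 0 < T) (hA : 0 ≤ A)
    (hR : 2 * (1 / √T * R) ≤ H + T * (1 / √T * M) ^ 2)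
    (hG : 2 / k * G ≤ A / 2 + T * ((1 - 2 / k) * (3 / 2 * (M * (1 / √T * M))))) :
    1 / T * (G + R) ≤ H / (2 * √T) + A / (2 * T * (1 - Real.exp (-2 / k)))
      + M ^ 2 * (1 + k) / √T := by
  have hk₀ : 0 < k := by linarith
  have hs : 0 < √T := Real.sqrt_pos.2 hT
  have hsq : √T ^ 2 = T := Real.sq_sqrt hT.le
  have hexp : 0 < 1 - Real.exp (-2 / k) :=
    sub_pos.2 (Real.exp_lt_one_iff.2 (div_neg_of_neg_of_pos (by norm_num) hk₀))
  have hexp' : 1 - Real.exp (-2 / k) ≤ 2 / k := by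
    have := Real.add_one_le_exp (-2 / k)
    rw [neg_div] at this ⊢
    linarith
  have hR' : 1 / T * R ≤ H / (2 * √T) + M ^ 2 / (2 * √T) := by
    calc 1 / T * R = 1 / (2 * √T) * (2 * (1 / √T * R)) := by
          nth_rw 1 [← hsq]
          field_simp
      _ ≤ 1 / (2 * √T) * (H + T * (1 / √T * M) ^ 2) := by gcongr
      _ = H / (2 * √T) + M ^ 2 / (2 * √T) := by
          nth_rw 2 [← hsq]
          field_simp
  have hG' : 1 / T * G ≤ A / (2 * T * (2 / k)) + 3 / 4 * (k - 2) * M ^ 2 / √T := by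
    calc 1 / T * G = k / (2 * T) * (2 / k * G) := by field_simp
      _ ≤ k / (2 * T) * (A / 2 + T * ((1 - 2 / k) * (3 / 2 * (M * (1 / √T * M))))) := by gcongr
      _ = A / (2 * T * (2 / k)) + 3 / 4 * (k - 2) * M ^ 2 / √T := by
          field_simp
          ring
  have hA' : A / (2 * T * (2 / k)) ≤ A / (2 * T * (1 - Real.exp (-2 / k))) := by
    gcongr
  have hM : M ^ 2 / (2 * √T) + 3 / 4 * (k - 2) * M ^ 2 / √T ≤ M ^ 2 * (1 + k) / √T := by
    rw [mul_comm 2, ← div_div, div_right_comm, ← add_div]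
    gcongr
    nlinarith [mul_nonneg hk₀.le (sq_nonneg M), sq_nonneg M]
  rw [mul_add]
  linarith

/-- (Gradient Replacement-Greedy convergence.) Under
smoothness, bounded gradients, convexity in `x`, the replacement-greedy
exchange inequality, and projected gradient updates with step `γ = 1/√T`,
the averaged iterate `x̄ = (1/T)∑ x_t` satisfies
`(1/2)·max_{|S|≤k} f(x̄,S) ≤ min_{x∈X} max_{|S|≤k} f(x,S)
  + H/(2√T) + A/(2T(1 − e^{−2/k})) + M²(1+k)/√T`. -/
theorem gradient_replacement_greedy_convergence
    {d : ℕ} (V : Type) [Fintype V] [DecidableEq V] (k : ℕ) (hk : 2 ≤ k)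
    (X : Set (EuclideanSpace ℝ (Fin d))) (hXne : X.Nonempty)
    (hXcl : IsClosed X) (hXconv : Convex ℝ X)
    (H M L A : ℝ) (hH : 0 < H) (hA : 0 ≤ A)
    (f : EuclideanSpace ℝ (Fin d) → Finset V → ℝ)
    (gradf : EuclideanSpace ℝ (Fin d) → Finset V → EuclideanSpace ℝ (Fin d))
    (hf_nonneg : ∀ x S, 0 ≤ f x S)
    (hconv : ∀ S : Finset V, S.card ≤ k → ConvexOn ℝ Set.univ (fun x => f x S))
    (hgrad : ∀ S : Finset V, S.card ≤ k →
      ∀ x, HasGradientAt (fun y => f y S) (gradf x S) x)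
    (hM : ∀ x, ∀ S : Finset V, S.card ≤ k → ‖gradf x S‖ ≤ M)
    (hL : ∀ S : Finset V, S.card ≤ k →
      ∀ x x', ‖gradf x' S - gradf x S‖ ≤ L * ‖x' - x‖)
    (T : ℕ) (hT : 0 < T) (hTL : L ≤ Real.sqrt T)
    (γ : ℝ) (hγ : γ = 1 / Real.sqrt T)
    (x : ℕ → EuclideanSpace ℝ (Fin d)) (S : ℕ → Finset V)
    (hx1 : x 1 ∈ X)
    (hbound : ∀ z ∈ X, ‖z - x 1‖ ^ 2 ≤ H)
    (hA_bound : ∀ S' : Finset V, S'.card ≤ k → f (x 1) S' ≤ A)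
    (hcard : ∀ t, 1 ≤ t → t ≤ T + 1 → (S t).card ≤ k)
    (hproj_mem : ∀ t, 1 ≤ t → t ≤ T → x (t + 1) ∈ X)
    (hproj : ∀ t, 1 ≤ t → t ≤ T → ∀ w ∈ X,
      ⟪(x t - γ • gradf (x t) (S t)) - x (t + 1), w - x (t + 1)⟫ ≤ 0)
    (hrep : ∀ t, 1 ≤ t → t ≤ T → ∀ S' : Finset V, S'.card ≤ k →
      (1 / (k : ℝ)) * (f (x (t + 1)) S' - 2 * f (x (t + 1)) (S t)) ≤
        f (x (t + 1)) (S (t + 1)) - f (x (t + 1)) (S t))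
    (xbar : EuclideanSpace ℝ (Fin d))
    (hxbar : xbar = (1 / (T : ℝ)) • ∑ t ∈ Finset.Icc 1 T, x t) :
    (1 / 2) * maxCard k (f xbar) ≤
      sInf ((fun z => maxCard k (f z)) '' X)
        + H / (2 * Real.sqrt T)
        + A / (2 * T * (1 - Real.exp (-2 / (k : ℝ))))
        + M ^ 2 * (1 + k) / Real.sqrt T := by
  have hT₀ : (0 : ℝ) < T := by exact_mod_cast hT
  have hk₂ : (2 : ℝ) ≤ k := by exact_mod_cast hk
  have hγ₀ : 0 ≤ γ := hγ ▸ by positivity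
  have hM₀ : 0 ≤ M := (norm_nonneg _).trans (hM 0 ∅ (by simp))
  have hq₀ : 0 ≤ 1 - 2 / (k : ℝ) := sub_nonneg.2 ((div_le_one (by linarith)).2 hk₂)
  have hreindex {N : Type} [AddCommMonoid N] (φ : ℕ → N) :
      ∑ t ∈ Finset.Icc 1 T, φ t = ∑ t ∈ Finset.range T, φ (t + 1) := by
    rw [Finset.range_eq_Ico, Finset.sum_Ico_add' φ 0 T 1]
    rfl
  have hmem : ∀ t ≤ T, x (t + 1) ∈ X := by
    rintro (_ | t) ht
    · exact hx1
    · exact hproj_mem (t + 1) (by omega) ht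
  have hcard' : ∀ t ≤ T, (S (t + 1)).card ≤ k := fun t ht => hcard (t + 1) (by omega) (by omega)
  have hstep_norm : ∀ t < T, ‖γ • gradf (x (t + 1)) (S (t + 1))‖ ≤ γ * M := by
    intro t ht
    rw [norm_smul, Real.norm_of_nonneg hγ₀]
    gcongr
    exact hM _ _ (hcard' t ht.le)
  have hdrift : ∀ t < T, ∀ S' : Finset V, S'.card ≤ k →
      |f (x (t + 1 + 1)) S' - f (x (t + 1)) S'| ≤ M * (γ * M) := by
    intro t ht S' hS'
    refine ((hconv S' hS').abs_sub_le_of_norm_gradient_le (hgrad S' hS')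
      (fun y => hM y S' hS') _ _).trans ?_
    gcongr
    exact (norm_sub_le_of_inner_sub_le_zero
      (hproj (t + 1) (by omega) ht _ (hmem t ht.le))).trans (hstep_norm t ht)
  have hgap : ∀ S' : Finset V, S'.card ≤ k →
      2 / (k : ℝ) * ∑ t ∈ Finset.range T,
          (1 / 2 * f (x (t + 1)) S' - f (x (t + 1)) (S (t + 1))) ≤
        A / 2 + T * ((1 - 2 / k) * (3 / 2 * (M * (γ * M)))) := by
    intro S' hS'
    have := sum_range_le_of_le_mul_add hq₀ (by linarith [show 0 ≤ 2 / (k : ℝ) by positivity])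
      (δ := 3 / 2 * (M * (γ * M))) (by positivity) T (c := A / 2)
      (a := fun t => 1 / 2 * f (x (t + 1)) S' - f (x (t + 1)) (S (t + 1))) (by positivity)
      (by linarith [hA_bound S' hS', hf_nonneg (x (0 + 1)) (S (0 + 1))])
      (fun t ht => half_sub_le_of_exchange hk₂ (hrep (t + 1) (by omega) ht S' hS')
        (abs_le.1 (hdrift t ht S' hS')).2
        (by linarith [(abs_le.1 (hdrift t ht _ (hcard' t ht.le))).1]))
    rwa [sub_sub_cancel] at this
  have hregret : ∀ z ∈ X,
      2 * (γ * ∑ t ∈ Finset.range T,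
          (f (x (t + 1)) (S (t + 1)) - f z (S (t + 1)))) ≤ H + T * (γ * M) ^ 2 := by
    intro z hz
    have hlin := two_mul_sum_inner_le_of_projected_steps (y := fun t => x (t + 1))
      (v := fun t => γ • gradf (x (t + 1)) (S (t + 1))) T
      (fun t ht => hproj (t + 1) (by omega) ht z hz) hstep_norm
    have hle : γ * ∑ t ∈ Finset.range T, (f (x (t + 1)) (S (t + 1)) - f z (S (t + 1))) ≤
        ∑ t ∈ Finset.range T,
          ⟪γ • gradf (x (t + 1)) (S (t + 1)), x (t + 1) - z⟫ := by
      rw [Finset.mul_sum]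
      refine Finset.sum_le_sum fun t ht => ?_
      have hc := hcard' t (Finset.mem_range.1 ht).le
      have hfirst := (hconv _ hc).add_inner_gradient_le (hgrad _ hc (x (t + 1))) z
      rw [← neg_sub (x (t + 1)) z, inner_neg_right] at hfirst
      rw [real_inner_smul_left]
      gcongr
      linarith
    have hdist : ‖x (0 + 1) - z‖ ^ 2 ≤ H := norm_sub_rev z (x 1) ▸ hbound z hz
    linarith
  have hbar : ∀ S' : Finset V, S'.card ≤ k →
      f xbar S' ≤ 1 / T * ∑ t ∈ Finset.range T, f (x (t + 1)) S' := by
    intro S' hS'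
    rw [hxbar, hreindex, Finset.smul_sum, Finset.mul_sum]
    refine (hconv S' hS').map_sum_le (fun _ _ => by positivity) ?_ fun _ _ => Set.mem_univ _
    simp [hT₀.ne']
  have hmax : ∀ z (S' : Finset V), S'.card ≤ k → f z S' ≤ maxCard k (f z) := fun z S' hS' =>
    Finset.le_sup' (f z) (by simpa using hS')
  have hmain : ∀ z ∈ X, ∀ S' : Finset V, S'.card ≤ k →
      1 / 2 * f xbar S' ≤ maxCard k (f z) + (H / (2 * √T)
        + A / (2 * T * (1 - Real.exp (-2 / (k : ℝ)))) + M ^ 2 * (1 + k) / √T) := by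
    intro z hz S' hS'
    have havg := average_bounds_le hk₂ hT₀ hA (hγ ▸ hregret z hz) (hγ ▸ hgap S' hS')
    have hz_avg : 1 / (T : ℝ) * ∑ t ∈ Finset.range T, f z (S (t + 1)) ≤ maxCard k (f z) := by
      have hsum := Finset.sum_le_card_nsmul (Finset.range T) (fun t => f z (S (t + 1))) _
        fun t ht => hmax z _ (hcard' t (Finset.mem_range.1 ht).le)
      rw [Finset.card_range, nsmul_eq_mul] at hsum
      rw [one_div_mul_eq_div]
      exact (div_le_iff₀' hT₀).2 hsum
    have hbar' := hbar S' hS'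
    simp only [Finset.sum_sub_distrib, ← Finset.mul_sum] at havg
    linear_combination havg + hz_avg + 1 / 2 * hbar'
  rw [add_assoc, add_assoc, ← add_assoc (H / _), ← sub_le_iff_le_add]
  refine le_csInf (hXne.image _) ?_
  rintro _ ⟨z, hz, rfl⟩
  obtain ⟨S', hS', hval⟩ := Finset.exists_mem_eq_sup' (s := (Finset.univ : Finset (Finset V)).filter
    (fun S => S.card ≤ k)) ⟨∅, by simp⟩ (f xbar)
  rw [sub_le_iff_le_add, maxCard, hval]
  exact hmain z hz S' (by simpa using hS')
end

section
/- (Proposition 1: equivalence with the multilinear extension.) Let (V, 𝓘) be a matroid on a finite set V, let X ⊆ ℝ^d be nonempty and compact, and let f : ℝ^d × 2^V → [0, ∞) be such that f(·, S) is continuous for every S ⊆ V and f(x, ·) is monotone and submodular for every x. Define the multilinear extension F : ℝ^d × ℝ^V → ℝ by F(x, y) = ∑_{S ⊆ V} f(x, S) ∏_{i ∈ S} y_i ∏_{i ∉ S} (1 − y_i), and let K = conv{ 1_S : S ∈ 𝓘 } ⊆ [0,1]^V. Then min_{x ∈ X} max_{S ∈ 𝓘} f(x, S) = min_{x ∈ X}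 max_{y ∈ K} F(x, y), all four extrema being attained. -/
/-- The multilinear extension of a set function `g : 2^V → ℝ`:
`F(y) = ∑_{S ⊆ V} g(S) ∏_{i ∈ S} y_i ∏_{i ∉ S} (1 − y_i)`. -/
noncomputable def multilinearExt {V : Type} [Fintype V] [DecidableEq V]
    (g : Finset V → ℝ) (y : V → ℝ) : ℝ :=
  ∑ S : Finset V, g S * ((∏ i ∈ S, y i) * ∏ i ∈ Sᶜ, (1 - y i))

section MultilinearExt

variable {V : Type} [Fintype V] [DecidableEq V]

lemma multilinearExt_eq_sum_powerset_compl (g : Finset V → ℝ) (y : V → ℝ) (i : V) :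
    multilinearExt g y = ∑ S ∈ ({i}ᶜ : Finset V).powerset,
      (y i * g (insert i S) + (1 - y i) * g S) *
        ∏ k ∈ {i}ᶜ, if k ∈ S then y k else 1 - y k := by
  have weight (S : Finset V) : (∏ k ∈ S, y k) * ∏ k ∈ Sᶜ, (1 - y k) =
      (if i ∈ S then y i else 1 - y i) * ∏ k ∈ {i}ᶜ, if k ∈ S then y k else 1 - y k := by
    rw [← Fintype.prod_eq_mul_prod_compl i (fun k => if k ∈ S then y k else 1 - y k),
      Finset.prod_ite]
    congr 2 <;> ext <;> simp
  have huniv : (Finset.univ : Finset (Finset V)) = (insert i ({i}ᶜ : Finset V)).powerset := by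
    rw [Finset.insert_eq, Finset.union_compl, Finset.powerset_univ]
  rw [multilinearExt, huniv, Finset.sum_powerset_insert (by simp), ← Finset.sum_add_distrib]
  refine Finset.sum_congr rfl fun S hS => ?_
  have hi : i ∉ S := by
    simpa using Finset.notMem_mono (Finset.mem_powerset.1 hS) (by simp : i ∉ ({i}ᶜ : Finset V))
  have hprod : (∏ k ∈ {i}ᶜ, if k ∈ insert i S then y k else 1 - y k) =
      ∏ k ∈ {i}ᶜ, if k ∈ S then y k else 1 - y k := by
    refine Finset.prod_congr rfl fun k hk => ?_
    have hk : k ≠ i := by simpa using hk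
    simp [hk]
  rw [weight, weight, hprod]
  simp only [hi, Finset.mem_insert_self, if_true, if_false]
  ring

lemma multilinearExt_eq_add (g : Finset V → ℝ) (y : V → ℝ) (i : V) :
    multilinearExt g y = y i * multilinearExt (fun S => g (insert i S)) y +
      (1 - y i) * multilinearExt (fun S => g (S.erase i)) y := by
  simp_rw [multilinearExt_eq_sum_powerset_compl _ y i]
  rw [Finset.mul_sum, Finset.mul_sum, ← Finset.sum_add_distrib]
  refine Finset.sum_congr rfl fun S hS => ?_
  have hi : i ∉ S := by
    simpa using Finset.notMem_mono (Finset.mem_powerset.1 hS) (by simp : i ∉ ({i}ᶜ : Finset V))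
  simp only [Finset.insert_idem, Finset.erase_insert hi, Finset.erase_eq_of_notMem hi]
  ring

lemma multilinearExt_update_of_insert_eq {g : Finset V → ℝ} {i : V}
    (hg : ∀ S, g (insert i S) = g S) (y : V → ℝ) (t : ℝ) :
    multilinearExt g (Function.update y i t) = multilinearExt g y := by
  simp_rw [multilinearExt_eq_sum_powerset_compl _ _ i, hg]
  refine Finset.sum_congr rfl fun S _ => ?_
  congr 1
  · ring
  · refine Finset.prod_congr rfl fun k hk => ?_
    have hk : k ≠ i := by simpa using hk
    simp [hk]

lemma multilinearExt_mono_left {g h : Finset V → ℝ} (hgh : ∀ S, g S ≤ h S) {y : V → ℝ}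
    (h0 : ∀ k, 0 ≤ y k) (h1 : ∀ k, y k ≤ 1) : multilinearExt g y ≤ multilinearExt h y :=
  Finset.sum_le_sum fun S _ => mul_le_mul_of_nonneg_right (hgh S) <|
    mul_nonneg (Finset.prod_nonneg fun k _ => h0 k)
      (Finset.prod_nonneg fun k _ => sub_nonneg.2 (h1 k))

lemma multilinearExt_add (g h : Finset V → ℝ) (y : V → ℝ) :
    multilinearExt (fun S => g S + h S) y = multilinearExt g y + multilinearExt h y := by
  simp only [multilinearExt, add_mul, Finset.sum_add_distrib]

lemma multilinearExt_indicator (g : Finset V → ℝ) (S : Finset V) :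
    multilinearExt g (fun i => if i ∈ S then 1 else 0) = g S := by
  rw [multilinearExt, Finset.sum_eq_single S]
  · rw [Finset.prod_congr rfl (fun i hi => if_pos hi),
      Finset.prod_congr (s₁ := Sᶜ) rfl (g := fun _ => (1 : ℝ))
        (fun i hi => by simp [Finset.mem_compl.1 hi])]
    simp
  · intro T _ hTS
    by_cases hT : T ⊆ S
    · obtain ⟨i, hiS, hiT⟩ := Finset.exists_of_ssubset (hT.ssubset_of_ne hTS)
      rw [Finset.prod_eq_zero (s := Tᶜ) (i := i) (by simpa using hiT) (by simp [hiS])]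
      simp
    · obtain ⟨i, hiT, hiS⟩ := Finset.not_subset.1 hT
      rw [Finset.prod_eq_zero (s := T) (i := i) hiT (by simp [hiS])]
      simp
  · simp

lemma multilinearExt_le_update {g : Finset V → ℝ} (hg : ∀ S T, S ⊆ T → g S ≤ g T) {y : V → ℝ}
    (h0 : ∀ k, 0 ≤ y k) (h1 : ∀ k, y k ≤ 1) {i : V} {t : ℝ} (ht : y i ≤ t) :
    multilinearExt g y ≤ multilinearExt g (Function.update y i t) := by
  have hle : multilinearExt (fun S => g (S.erase i)) y ≤
      multilinearExt (fun S => g (insert i S)) y :=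
    multilinearExt_mono_left
      (fun S => hg _ _ ((Finset.erase_subset i S).trans (Finset.subset_insert i S))) h0 h1
  rw [multilinearExt_eq_add g y i, multilinearExt_eq_add g _ i,
    multilinearExt_update_of_insert_eq (by simp), multilinearExt_update_of_insert_eq (by simp),
    Function.update_self]
  nlinarith

lemma multilinearExt_mono_right {g : Finset V → ℝ} (hg : ∀ S T, S ⊆ T → g S ≤ g T)
    {y z : V → ℝ} (h0 : ∀ k, 0 ≤ y k) (hyz : ∀ k, y k ≤ z k) (h1 : ∀ k, z k ≤ 1) :
    multilinearExt g y ≤ multilinearExt g z := by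
  have key (s : Finset V) : multilinearExt g y ≤ multilinearExt g (s.piecewise z y) := by
    induction s using Finset.induction_on with
    | empty => simp
    | insert i s hi ih =>
      rw [Finset.piecewise_insert]
      refine ih.trans (multilinearExt_le_update hg (fun k => ?_) (fun k => ?_) ?_)
      · by_cases hk : k ∈ s <;> simp [hk, h0 k, (h0 k).trans (hyz k)]
      · by_cases hk : k ∈ s <;> simp [hk, h1 k, (hyz k).trans (h1 k)]
      · simpa [hi] using hyz i
  simpa using key Finset.univ

/-- In two coordinates the multilinear extension of a submodular function is a bilinear
polynomial with nonpositive mixed coefficient. -/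
lemma exists_multilinearExt_update_update {g : Finset V → ℝ}
    (hg : ∀ S T, g (S ∩ T) + g (S ∪ T) ≤ g S + g T) {y : V → ℝ}
    (h0 : ∀ k, 0 ≤ y k) (h1 : ∀ k, y k ≤ 1) {i j : V} (hij : i ≠ j) :
    ∃ P Q R T : ℝ, P + T ≤ Q + R ∧ ∀ s t : ℝ,
      multilinearExt g (Function.update (Function.update y i s) j t) =
        s * t * P + s * (1 - t) * Q + (1 - s) * t * R + (1 - s) * (1 - t) * T := by
  refine ⟨multilinearExt (fun S => g (insert i (insert j S))) y,
    multilinearExt (fun S => g (insert i (S.erase j))) y,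
    multilinearExt (fun S => g ((insert j S).erase i)) y,
    multilinearExt (fun S => g ((S.erase j).erase i)) y, ?_, fun s t => ?_⟩
  · rw [← multilinearExt_add, ← multilinearExt_add]
    refine multilinearExt_mono_left (fun S => ?_) h0 h1
    have h := hg (insert i (S.erase j)) ((insert j S).erase i)
    have hinter : insert i (S.erase j) ∩ (insert j S).erase i = (S.erase j).erase i := by
      ext k; grind
    have hunion : insert i (S.erase j) ∪ (insert j S).erase i = insert i (insert j S) := by
      ext k; grind
    rw [hinter, hunion] at h
    linarith
  · have hindep (h : Finset V → ℝ) (hi : ∀ S, h (insert i S) = h S)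
        (hj : ∀ S, h (insert j S) = h S) :
        multilinearExt h (Function.update (Function.update y i s) j t) = multilinearExt h y := by
      rw [multilinearExt_update_of_insert_eq hj, multilinearExt_update_of_insert_eq hi]
    rw [multilinearExt_eq_add g _ i, multilinearExt_eq_add (fun S => g (insert i S)) _ j,
      multilinearExt_eq_add (fun S => g (S.erase i)) _ j, hindep, hindep, hindep, hindep]
    · simp only [Function.update_self, Function.update_of_ne hij]
      ring
    all_goals intro S; congr 1; ext k; grind

/-- The multilinear extension of a submodular function is convex along exchange directions, so
moving along one of the two opposite directions does not decrease it. -/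
lemma multilinearExt_le_exchange {g : Finset V → ℝ}
    (hg : ∀ S T, g (S ∩ T) + g (S ∪ T) ≤ g S + g T) {y : V → ℝ}
    (h0 : ∀ k, 0 ≤ y k) (h1 : ∀ k, y k ≤ 1) {i j : V} (hij : i ≠ j) {a b : ℝ}
    (ha : 0 ≤ a) (hb : 0 ≤ b) :
    multilinearExt g y ≤
        multilinearExt g (Function.update (Function.update y i (y i - a)) j (y j + a)) ∨
      multilinearExt g y ≤
        multilinearExt g (Function.update (Function.update y i (y i + b)) j (y j - b)) := by
  obtain ⟨P, Q, R, T, hPT, h⟩ := exists_multilinearExt_update_update hg h0 h1 hij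
  have hy := h (y i) (y j)
  rw [Function.update_eq_self, Function.update_eq_self] at hy
  rw [h, h, hy]
  have ha2 := mul_nonneg (mul_nonneg ha ha) (sub_nonneg.2 hPT)
  have hb2 := mul_nonneg (mul_nonneg hb hb) (sub_nonneg.2 hPT)
  set β := (y i - y j) * P - (y i + (1 - y j)) * Q + ((1 - y i) + y j) * R +
    (y i - y j) * T with hβ
  rcases le_total 0 β with hs | hs
  · left
    have := mul_nonneg ha hs
    rw [hβ] at this
    linarith
  · right
    have := mul_nonneg hb (neg_nonneg.2 hs)
    rw [hβ] at this
    linarith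

end MultilinearExt

lemma Matroid.IsBase.exists_symm_exchange {α : Type*} {M : Matroid α} {A B : Set α} {e : α}
    (hA : M.IsBase A) (hB : M.IsBase B) (he : e ∈ A \ B) :
    ∃ f ∈ B \ A, M.IsBase (insert f (A \ {e})) ∧ M.IsBase (insert e (B \ {f})) := by
  have heE : e ∈ M.E := hA.subset_ground he.1
  have hcl : e ∈ M.closure B := by rwa [hB.closure_eq]
  have hC := hB.indep.fundCircuit_isCircuit hcl he.2
  obtain ⟨f, hf, hfcl⟩ : ∃ f ∈ M.fundCircuit e B \ {e}, f ∉ M.closure (A \ {e}) := by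
    by_contra! h
    refine hA.indep.notMem_closure_sdiff_of_mem he.1 ?_
    exact M.closure_subset_closure_of_subset_closure h
      (hC.mem_closure_sdiff_singleton_of_mem (M.mem_fundCircuit e B))
  have hfe : f ≠ e := hf.2
  have hfB : f ∈ B := (M.fundCircuit_subset_insert e B hf.1).resolve_left hfe
  have hfA : f ∉ A := fun h =>
    hfcl (M.mem_closure_of_mem ⟨h, hfe⟩ (Set.sdiff_subset.trans hA.subset_ground))
  refine ⟨f, ⟨hfB, hfA⟩,
    hA.exchange_base_of_notMem_closure he.1 hfcl (hB.subset_ground hfB), ?_⟩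
  have hind := (hB.indep.mem_fundCircuit_iff hcl he.2).1 hf.1
  rw [← Set.insert_sdiff_singleton_comm hfe.symm] at hind
  exact hB.exchange_isBase_of_indep he.2 hind

section SwapRounding

variable {V : Type} [Fintype V] [DecidableEq V] {g : Finset V → ℝ} {M : Matroid V}

/-- Swap rounding: two weighted bases can be merged into one. -/
lemma exists_isBase_multilinearExt_le_merge (hg : ∀ S T, g (S ∩ T) + g (S ∪ T) ≤ g S + g T)
    {y : V → ℝ} {a b : ℝ} (ha : 0 ≤ a) (hb : 0 ≤ b) (h0 : ∀ k, 0 ≤ y k)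
    (h1 : ∀ k, y k + a + b ≤ 1) (A B : Finset V) (hA : M.IsBase (A : Set V))
    (hB : M.IsBase (B : Set V)) :
    ∃ C : Finset V, M.IsBase (C : Set V) ∧
      multilinearExt g (fun k => y k + a * (if k ∈ A then 1 else 0) +
        b * (if k ∈ B then 1 else 0)) ≤
      multilinearExt g (fun k => y k + (a + b) * (if k ∈ C then 1 else 0)) := by
  induction hn : (A \ B).card using Nat.strong_induction_on generalizing A B with
  | _ n ih =>
  subst hn
  rcases (A \ B).eq_empty_or_nonempty with hAB | ⟨e, he⟩
  · have hAB : A = B := Finset.coe_injective <|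
      hA.eq_of_subset_isBase hB (by exact_mod_cast Finset.sdiff_eq_empty_iff_subset.1 hAB)
    subst hAB
    refine ⟨A, hA, le_of_eq ?_⟩
    congr 1
    ext k
    ring
  · obtain ⟨f, hf, hA', hB'⟩ := hA.exists_symm_exchange hB (e := e) (by simpa using he)
    rw [Finset.mem_sdiff] at he
    have hf : f ∈ B ∧ f ∉ A := by simpa using hf
    have hef : e ≠ f := fun h => hf.2 (h ▸ he.1)
    have hlt : ((A \ B).erase e).card < (A \ B).card :=
      Finset.card_erase_lt_of_mem (Finset.mem_sdiff.2 he)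
    have hdA : insert f (A.erase e) \ B = (A \ B).erase e := by ext k; grind
    have hdB : A \ insert e (B.erase f) = (A \ B).erase e := by ext k; grind
    rcases multilinearExt_le_exchange hg (y := fun k => y k + a * (if k ∈ A then 1 else 0) +
        b * (if k ∈ B then 1 else 0))
        (fun k => by have := h0 k; split_ifs <;> linarith)
        (fun k => by have := h1 k; split_ifs <;> linarith) hef ha hb with h | h
    · obtain ⟨C, hC, hle⟩ := ih _ (hdA ▸ hlt) (insert f (A.erase e)) B
        (by simpa using hA') hB rfl
      refine ⟨C, hC, h.trans (le_trans (le_of_eq ?_) hle)⟩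
      congr 1
      ext k
      rcases eq_or_ne k f with rfl | hkf
      · simp [hf, he]; ring
      rcases eq_or_ne k e with rfl | hke
      · simp [hf, he, hkf]
      simp [hkf, hke]
    · obtain ⟨C, hC, hle⟩ := ih _ (hdB ▸ hlt) A (insert e (B.erase f)) hA
        (by simpa using hB') rfl
      refine ⟨C, hC, h.trans (le_trans (le_of_eq ?_) hle)⟩
      congr 1
      ext k
      rcases eq_or_ne k f with rfl | hkf
      · simp [hf, hef.symm]
      rcases eq_or_ne k e with rfl | hke
      · simp [he, hkf]
      simp [hkf, hke]

lemma exists_isBase_multilinearExt_le_sum (hg : ∀ S T, g (S ∩ T) + g (S ∪ T) ≤ g S + g T)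
    {ι : Type*} {s : Finset ι} (hs : s.Nonempty) (w : ι → ℝ) (hw : ∀ i ∈ s, 0 ≤ w i)
    (B : ι → Finset V) (hB : ∀ i ∈ s, M.IsBase (B i : Set V)) (y : V → ℝ) (h0 : ∀ k, 0 ≤ y k)
    (h1 : ∀ k, y k + ∑ i ∈ s, w i ≤ 1) :
    ∃ C : Finset V, M.IsBase (C : Set V) ∧
      multilinearExt g (fun k => y k + ∑ i ∈ s, w i * (if k ∈ B i then 1 else 0)) ≤
      multilinearExt g (fun k => y k + (∑ i ∈ s, w i) * (if k ∈ C then 1 else 0)) := by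
  classical
  induction hs using Finset.Nonempty.cons_induction generalizing y with
  | singleton i => exact ⟨B i, hB i (by simp), by simp⟩
  | cons i s hi hs ih =>
    simp only [Finset.mem_cons, forall_eq_or_imp] at hw hB
    simp only [Finset.sum_cons] at h1 ⊢
    obtain ⟨C, hC, hle⟩ := ih hw.2 hB.2 (fun k => y k + w i * (if k ∈ B i then 1 else 0))
      (fun k => by have := h0 k; have := hw.1; split_ifs <;> linarith)
      (fun k => by have := h1 k; have := hw.1; split_ifs <;> linarith)
    obtain ⟨D, hD, hle'⟩ := exists_isBase_multilinearExt_le_merge hg hw.1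
      (Finset.sum_nonneg hw.2) h0 (fun k => by have := h1 k; linarith) (B i) C hB.1 hC
    refine ⟨D, hD, le_trans ?_ hle'⟩
    simpa only [add_assoc] using hle

/-- The multilinear extension of a monotone submodular function on the independence polytope is
bounded by the value at some independent set. -/
lemma exists_indep_multilinearExt_le (hmono : ∀ S T, S ⊆ T → g S ≤ g T)
    (hg : ∀ S T, g (S ∩ T) + g (S ∪ T) ≤ g S + g T) {y : V → ℝ}
    (hy : y ∈ convexHull ℝ {y | ∃ S : Finset V, M.Indep (S : Set V) ∧
      y = fun i => if i ∈ S then (1 : ℝ) else 0}) :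
    ∃ C : Finset V, M.Indep (C : Set V) ∧ multilinearExt g y ≤ g C := by
  rw [convexHull_eq] at hy
  obtain ⟨ι, s, w, z, hw, hw1, hz, rfl⟩ := hy
  have hB (i : ι) : ∃ B : Finset V, i ∈ s →
      M.IsBase (B : Set V) ∧ ∀ k, 0 ≤ z i k ∧ z i k ≤ if k ∈ B then 1 else 0 := by
    by_cases hi : i ∈ s
    · obtain ⟨S, hS, hzS⟩ := hz i hi
      obtain ⟨B, hB, hSB⟩ := hS.exists_isBase_superset
      lift B to Finset V using B.toFinite
      refine ⟨B, fun _ => ⟨hB, fun k => ?_⟩⟩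
      have := @hSB k
      simp only [Finset.mem_coe] at this
      rw [hzS]
      dsimp only
      split_ifs <;> simp_all
    · exact ⟨∅, fun h => absurd h hi⟩
  choose B hB using hB
  have hs : s.Nonempty := by
    rw [Finset.nonempty_iff_ne_empty]
    rintro rfl
    simp at hw1
  obtain ⟨C, hC, hle⟩ := exists_isBase_multilinearExt_le_sum hg hs w hw B (fun i hi => (hB i hi).1)
    0 (fun _ => le_rfl) (by simp [hw1])
  refine ⟨C, hC.indep, ?_⟩
  simp only [Pi.zero_apply, zero_add, hw1, one_mul, multilinearExt_indicator] at hle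
  refine le_trans (multilinearExt_mono_right hmono (fun k => ?_) (fun k => ?_) (fun k => ?_)) hle
  · rw [Finset.centerMass_eq_of_sum_1 _ _ hw1, Finset.sum_apply]
    exact Finset.sum_nonneg fun i hi => mul_nonneg (hw i hi) ((hB i hi).2 k).1
  · rw [Finset.centerMass_eq_of_sum_1 _ _ hw1, Finset.sum_apply]
    exact Finset.sum_le_sum fun i hi => mul_le_mul_of_nonneg_left ((hB i hi).2 k).2 (hw i hi)
  · refine le_trans (Finset.sum_le_sum fun i hi => mul_le_of_le_one_right (hw i hi) ?_) hw1.le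
    split_ifs <;> norm_num

end SwapRounding

/-- (Equivalence with the multilinear extension.) For a
matroid `(V, 𝓘)`, a nonempty compact `X ⊆ ℝ^d`, and a convex–(monotone
submodular) function `f ≥ 0` with `f(·,S)` continuous, letting `F` be the
multilinear extension in the discrete variable and
`K = conv{1_S : S ∈ 𝓘}`, we have
`min_{x∈X} max_{S∈𝓘} f(x,S) = min_{x∈X} max_{y∈K} F(x,y)`. -/
theorem minimax_eq_multilinear_minimax
    (d : ℕ) (V : Type) [Fintype V] [DecidableEq V]
    (𝓘 : Finset (Finset V)) (h𝓘 : 𝓘.Nonempty)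
    (hdown : ∀ A B : Finset V, A ⊆ B → B ∈ 𝓘 → A ∈ 𝓘)
    (hexch : ∀ A B : Finset V, A ∈ 𝓘 → B ∈ 𝓘 → A.card < B.card →
      ∃ e ∈ B \ A, insert e A ∈ 𝓘)
    (X : Set (EuclideanSpace ℝ (Fin d))) (hXne : X.Nonempty) (hXc : IsCompact X)
    (f : EuclideanSpace ℝ (Fin d) → Finset V → ℝ)
    (hf_nonneg : ∀ x S, 0 ≤ f x S)
    (hf_cont : ∀ S : Finset V, Continuous fun x => f x S)
    (hmono : ∀ x, ∀ S T : Finset V, S ⊆ T → f x S ≤ f x T)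
    (hsub : ∀ x, ∀ S T : Finset V, f x (S ∩ T) + f x (S ∪ T) ≤ f x S + f x T)
    (K : Set (V → ℝ))
    (hK : K = convexHull ℝ
      {y | ∃ S ∈ 𝓘, y = fun i => if i ∈ S then (1 : ℝ) else 0}) :
    sInf ((fun x => 𝓘.sup' h𝓘 (fun S => f x S)) '' X) =
      sInf ((fun x => sSup ((fun y => multilinearExt (f x) y) '' K)) '' X) := by
  suffices h : ∀ x, 𝓘.sup' h𝓘 (fun S => f x S) =
      sSup ((fun y => multilinearExt (f x) y) '' K) by
    simp only [h]
  intro x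
  have ⟨S₀, hS₀⟩ := h𝓘
  let M : Matroid V := (IndepMatroid.ofFinset Set.univ (· ∈ 𝓘)
    (hdown ∅ S₀ (Finset.empty_subset _) hS₀) (fun A B hB hAB => hdown A B hAB hB)
    (fun A B hA hB hAB => by
      simpa only [Finset.mem_sdiff, and_assoc] using hexch A B hA hB hAB)
    (fun _ _ => Set.subset_univ _)).matroid
  have hM (S : Finset V) : M.Indep (S : Set V) ↔ S ∈ 𝓘 := by
    simp [M, IndepMatroid.matroid_Indep]
  obtain ⟨S, hS, hmax⟩ := 𝓘.exists_mem_eq_sup' h𝓘 (fun S => f x S)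
  refine (IsGreatest.csSup_eq (s := (fun y => multilinearExt (f x) y) '' K)
    ⟨⟨fun i => if i ∈ S then 1 else 0, ?_, ?_⟩, ?_⟩).symm
  · rw [hK]
    exact subset_convexHull ℝ _ ⟨S, hS, rfl⟩
  · exact (multilinearExt_indicator (f x) S).trans hmax.symm
  · rintro _ ⟨y, hy, rfl⟩
    simp only [hK, ← hM] at hy
    obtain ⟨C, hC, hle⟩ := exists_indep_multilinearExt_le (hmono x) (hsub x) hy
    exact hle.trans (Finset.le_sup' (fun S => f x S) ((hM C).1 hC))
end
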